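/- arXiv:1505.03136 — 2 statements merged into one kernel-verified Lean document; each statement's English description precedes it below -/
import Mathlib

section
/- Pushouts of rows of subtraction sequences form a subtraction sequence: consider schemes arranged in a 3×3 diagram with rows X' ← W' → Y', X ← W → Y, X'' ← W'' → Y'', where all six horizontal maps from the middle column are closed immersions (W' → X', W' → Y', W → X, W → Y, W'' → X'', W'' → Y''), the vertical maps X' → X, W' → W, Y' → Y are closed immersions, the vertical maps X'' → X, W'' → W, Y'' → Y are open immersions, each column (X' → X ← X'', W' → W ← W'', Y' → Y ← Y'') is a subtraction sequence, all six small squares commute, and the two top squares (W' → X' → X over W → X, and W' → Y' → Y over W → Y) are pullback (cartesian) squares. Then the induced morphisms on the row-wise pushouts form a subtraction sequence X' ⊔_{W'} Y' → X ⊔_W Y ← X'' ⊔_{W''} Y'': the first induced morphism is a closed immersion, the second is an open immersion, and the set-theoretic image of the second is the complement of the set-theoretic image of the first in X ⊔_W Y. -/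
open AlgebraicGeometry CategoryTheory CategoryTheory.Limits

universe u

namespace AlgebraicGeometry.PresheafedSpace

open TopologicalSpace Opposite

/-- The map on sections induced by a morphism, followed by restriction to a smaller open. -/
def appLE {X Y : PresheafedSpace.{u, u + 1, u} CommRingCat.{u}} (f : X ⟶ Y) (U : Opens Y)
    (V : Opens X) (h : V ≤ (Opens.map f.base).obj U) :
    Y.presheaf.obj (op U) ⟶ X.presheaf.obj (op V) :=
  f.c.app (op U) ≫ X.presheaf.map (homOfLE h).op

/-- A commutative square exhibiting `P` as the union of two closed subspaces `X` and `Y` glued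
along `W`, with sections of `P` being pairs of sections of `X` and `Y` that agree on `W`. -/
structure IsGluing {W X Y P : PresheafedSpace.{u, u + 1, u} CommRingCat.{u}}
    (a : W ⟶ X) (b : W ⟶ Y) (i : X ⟶ P) (j : Y ⟶ P) : Prop where
  w : a ≫ i = b ≫ j
  surj (p : P) : p ∈ Set.range i.base ∨ p ∈ Set.range j.base
  isClosedEmbedding_left : Topology.IsClosedEmbedding i.base
  isClosedEmbedding_right : Topology.IsClosedEmbedding j.base
  exists_of_eq (x : X) (y : Y) (h : i.base x = j.base y) : ∃ z, a.base z = x ∧ b.base z = y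
  section_ext (U : Opens P) (s t : P.presheaf.obj (op U))
    (h₁ : i.c.app (op U) s = i.c.app (op U) t) (h₂ : j.c.app (op U) s = j.c.app (op U) t) : s = t
  section_exists (U : Opens P) (V : Opens W)
    (hV : (Opens.map a.base).obj ((Opens.map i.base).obj U) ≤ V)
    (ha : V ≤ (Opens.map a.base).obj ((Opens.map i.base).obj U))
    (hb : V ≤ (Opens.map b.base).obj ((Opens.map j.base).obj U))
    (s : X.presheaf.obj (op ((Opens.map i.base).obj U)))
    (t : Y.presheaf.obj (op ((Opens.map j.base).obj U)))
    (h : appLE a _ V ha s = appLE b _ V hb t) :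
    ∃ r : P.presheaf.obj (op U), i.c.app (op U) r = s ∧ j.c.app (op U) r = t

namespace IsGluing

variable {W X Y P : PresheafedSpace.{u, u + 1, u} CommRingCat.{u}} {a : W ⟶ X} {b : W ⟶ Y}
  {i : X ⟶ P} {j : Y ⟶ P}

lemma of_comp_isIso {Q : PresheafedSpace.{u, u + 1, u} CommRingCat.{u}} (e : P ⟶ Q) [IsIso e]
    (h : IsGluing a b (i ≫ e) (j ≫ e)) : IsGluing a b i j := by
  have he : IsHomeomorph e.base :=
    (TopCat.homeoOfIso ((PresheafedSpace.forget _).mapIso (asIso e))).isHomeomorph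
  have hU : ∀ U : Opens P, ∃ V : Opens Q, (Opens.map e.base).obj V = U := fun U ↦ by
    obtain ⟨V, hV, hVU⟩ := he.isInducing.isOpen_iff.mp U.2
    exact ⟨⟨V, hV⟩, Opens.ext hVU⟩
  have := PresheafedSpace.c_isIso_of_iso e
  refine ⟨by simpa [← cancel_mono e] using h.w, fun p ↦ ?_, ?_, ?_, fun x y hxy ↦ ?_,
    fun U s t h₁ h₂ ↦ ?_, fun U V hV ha hb s t hst ↦ ?_⟩
  · obtain ⟨x, hx⟩ | ⟨x, hx⟩ := h.surj (e.base p)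
    · exact .inl ⟨x, he.injective hx⟩
    · exact .inr ⟨x, he.injective hx⟩
  · exact he.isClosedEmbedding.of_comp_iff.mp h.isClosedEmbedding_left
  · exact he.isClosedEmbedding.of_comp_iff.mp h.isClosedEmbedding_right
  · exact h.exists_of_eq x y (congr_arg e.base hxy)
  · obtain ⟨U, rfl⟩ := hU U
    obtain ⟨s, rfl⟩ := (ConcreteCategory.bijective_of_isIso (e.c.app (op U))).2 s
    obtain ⟨t, rfl⟩ := (ConcreteCategory.bijective_of_isIso (e.c.app (op U))).2 t
    exact congr_arg _ (h.section_ext U s t h₁ h₂)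
  · obtain ⟨U, rfl⟩ := hU U
    obtain ⟨r, hr⟩ := h.section_exists U V hV ha hb s t hst
    exact ⟨e.c.app _ r, hr⟩

lemma of_isPushout_top (h : IsPushout a b i j)
    (ha : Topology.IsClosedEmbedding a.base) (hb : Topology.IsClosedEmbedding b.base) :
    (∀ p : P, p ∈ Set.range i.base ∨ p ∈ Set.range j.base) ∧
    Topology.IsClosedEmbedding i.base ∧ Topology.IsClosedEmbedding j.base ∧
    ∀ (x : X) (y : Y), i.base x = j.base y → ∃ z, a.base z = x ∧ b.base z = y := by
  have : PreservesColimitsOfShape WalkingSpan (PresheafedSpace.forget CommRingCat.{u}) := by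
    infer_instance
  have : PreservesColimit (span a b) (PresheafedSpace.forget CommRingCat.{u}) :=
    this.preservesColimit
  have h₁ := h.map (PresheafedSpace.forget CommRingCat.{u})
  have h₂ := h₁.map (CategoryTheory.forget TopCat)
  have hc (Z : Set P) : IsClosed Z ↔ IsClosed (i.base ⁻¹' Z) ∧ IsClosed (j.base ⁻¹' Z) := by
    refine ⟨fun h ↦ ⟨h.preimage i.base.hom.2, h.preimage j.base.hom.2⟩, fun h ↦ ?_⟩
    refine (TopCat.isClosed_iff_of_isColimit _ h₁.isColimit Z).mpr ?_
    rintro (_ | _ | _)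
    · exact h.1.preimage (a.base.hom.2)
    · exact h.1
    · exact h.2
  have hex : ∀ (x : X) (y : Y), i.base x = j.base y → ∃ z, a.base z = x ∧ b.base z = y := by
    intro x y hxy
    have := Types.isPullback_of_isPushout h₂ ha.injective
    obtain ⟨z, hz⟩ := (Types.isPullback_iff _ _ _ _).mp this |>.2.2 x y hxy
    exact ⟨z, hz⟩
  have hcl {X Y : PresheafedSpace.{u, u + 1, u} CommRingCat.{u}} {a : W ⟶ X} {b : W ⟶ Y}
      {i : X ⟶ P} {j : Y ⟶ P} (w : a ≫ i = b ≫ j)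
      (hb : Topology.IsClosedEmbedding b.base) (hi : Function.Injective i.base)
      (hex : ∀ (x : X) (y : Y), i.base x = j.base y → ∃ z, a.base z = x ∧ b.base z = y)
      (hc : ∀ Z : Set P, IsClosed Z ↔ IsClosed (i.base ⁻¹' Z) ∧ IsClosed (j.base ⁻¹' Z)) :
      Topology.IsClosedEmbedding i.base := by
    refine .of_continuous_injective_isClosedMap i.base.hom.2 hi fun Z hZ ↦ (hc _).mpr ⟨?_, ?_⟩
    · rwa [Set.preimage_image_eq _ hi]
    · convert hb.isClosedMap _ (hZ.preimage a.base.hom.2) using 1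
      ext y
      constructor
      · rintro ⟨x, hx, hxy⟩
        obtain ⟨z, rfl, rfl⟩ := hex x y hxy
        exact ⟨z, hx, rfl⟩
      · rintro ⟨z, hz, rfl⟩
        exact ⟨_, hz, congr($(w).base z)⟩
  refine ⟨fun p ↦ ?_, hcl h.w hb ?_ hex hc, hcl h.w.symm ha ?_ ?_ ?_, hex⟩
  · obtain ⟨x, hx⟩ | ⟨x, hx⟩ := Types.eq_or_eq_of_isPushout h₂ p
    · exact .inl ⟨x, hx⟩
    · exact .inr ⟨x, hx⟩
  · exact Types.pushoutCocone_inr_injective_of_isColimit h₂.flip.isColimit hb.injective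
  · exact Types.pushoutCocone_inr_injective_of_isColimit h₂.isColimit ha.injective
  · intro x y hxy
    obtain ⟨z, hz, hz'⟩ := hex y x hxy.symm
    exact ⟨z, hz', hz⟩
  · exact fun Z ↦ (hc Z).trans and_comm

lemma pushout_section_ext (U : Opens (pushout a b : PresheafedSpace.{u, u + 1, u} CommRingCat.{u}))
    (s t : (pushout a b).presheaf.obj (op U))
    (h₁ : (pushout.inl a b).c.app (op U) s = (pushout.inl a b).c.app (op U) t)
    (h₂ : (pushout.inr a b).c.app (op U) s = (pushout.inr a b).c.app (op U) t) : s = t := by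
  let e := colimitPresheafObjIsoComponentwiseLimit (span a b) U
  have he := ConcreteCategory.bijective_of_isIso e.hom
  apply he.1
  have key (k) : limit.π (componentwiseDiagram (span a b) U) (op k) (e.hom s) =
      (colimit.ι (span a b) k).c.app (op U) s :=
    congr($(colimitPresheafObjIsoComponentwiseLimit_hom_π (span a b) U k) s)
  have key' (k) : limit.π (componentwiseDiagram (span a b) U) (op k) (e.hom t) =
      (colimit.ι (span a b) k).c.app (op U) t :=
    congr($(colimitPresheafObjIsoComponentwiseLimit_hom_π (span a b) U k) t)
  have hl : limit.π (componentwiseDiagram (span a b) U) (op .left) (e.hom s) =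
      limit.π (componentwiseDiagram (span a b) U) (op .left) (e.hom t) := by
    rw [key, key']; exact h₁
  refine Concrete.limit_ext _ _ _ ?_
  rintro ⟨_ | _ | _⟩
  · have := limit.w (componentwiseDiagram (span a b) U) (WalkingSpan.Hom.fst.op)
    rw [← this]
    simp only [CommRingCat.comp_apply]
    exact congr_arg _ hl
  · exact hl
  · rw [key, key']; exact h₂

lemma pushout_section_exists
    (U : Opens (pushout a b : PresheafedSpace.{u, u + 1, u} CommRingCat.{u})) (V : Opens W)
    (hV : (Opens.map a.base).obj ((Opens.map (pushout.inl a b).base).obj U) ≤ V)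
    (ha : V ≤ (Opens.map a.base).obj ((Opens.map (pushout.inl a b).base).obj U))
    (hb : V ≤ (Opens.map b.base).obj ((Opens.map (pushout.inr a b).base).obj U))
    (s : X.presheaf.obj (op ((Opens.map (pushout.inl a b).base).obj U)))
    (t : Y.presheaf.obj (op ((Opens.map (pushout.inr a b).base).obj U)))
    (h : appLE a _ V ha s = appLE b _ V hb t) :
    ∃ r : (pushout a b).presheaf.obj (op U),
      (pushout.inl a b).c.app (op U) r = s ∧ (pushout.inr a b).c.app (op U) r = t := by
  let e := colimitPresheafObjIsoComponentwiseLimit (span a b) U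
  have he := ConcreteCategory.bijective_of_isIso e.hom
  let D := componentwiseDiagram (span a b) U
  have hD : IsLimit ((CategoryTheory.forget CommRingCat.{u}).mapCone (limit.cone D)) :=
    isLimitOfPreserves _ (limit.isLimit D)
  have key (k) (s) : limit.π (componentwiseDiagram (span a b) U) (op k) (e.hom s) =
      (colimit.ι (span a b) k).c.app (op U) s :=
    congr($(colimitPresheafObjIsoComponentwiseLimit_hom_π (span a b) U k) s)
  have hVeq : V = (Opens.map (colimit.ι (span a b) .zero).base).obj U := by
    rw [← colimit.w (span a b) WalkingSpan.Hom.fst]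
    exact le_antisymm ha hV
  let z : W.presheaf.obj (op ((Opens.map (colimit.ι (span a b) .zero).base).obj U)) :=
    appLE a _ _ (hVeq.symm.le.trans ha) s
  have hs : D.map WalkingSpan.Hom.fst.op s = z := by
    simp [D, z, appLE]
    rfl
  have ht : D.map WalkingSpan.Hom.snd.op t = z := by
    subst hVeq
    simp only [z, h]
    rfl
  let x : ∀ k : WalkingSpanᵒᵖ, D.obj k := fun k ↦
    match k with
    | op none => z
    | op (some .left) => s
    | op (some .right) => t
  have hx : x ∈ (D ⋙ CategoryTheory.forget CommRingCat.{u}).sections := by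
    rintro ⟨_ | _ | _⟩ ⟨_ | _ | _⟩ ⟨_ | _⟩
    · exact congr($(D.map_id _) z)
    · exact hs
    · exact congr($(D.map_id _) s)
    · exact ht
    · exact congr($(D.map_id _) t)
  obtain ⟨y, hy⟩ := (Types.isLimit_iff _).mp ⟨hD⟩ x hx
  obtain ⟨r, rfl⟩ := he.2 y
  exact ⟨r, (key _ _).symm.trans (hy.1 (op .left)), (key _ _).symm.trans (hy.1 (op .right))⟩

/-- A pushout of closed embeddings of (pre)sheafed spaces is a gluing. -/
lemma of_isPushout (h : IsPushout a b i j)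
    (ha : Topology.IsClosedEmbedding a.base) (hb : Topology.IsClosedEmbedding b.base) :
    IsGluing a b i j := by
  have hpo := IsPushout.of_hasPushout a b
  refine of_comp_isIso h.isoPushout.hom ?_
  rw [h.inl_isoPushout_hom, h.inr_isoPushout_hom]
  obtain ⟨h₁, h₂, h₃, h₄⟩ := of_isPushout_top hpo ha hb
  exact ⟨hpo.w, h₁, h₂, h₃, h₄, pushout_section_ext, pushout_section_exists⟩

end IsGluing

section AppLE

variable {X Y Z : PresheafedSpace.{u, u + 1, u} CommRingCat.{u}}

lemma appLE_self (f : X ⟶ Y) (U : Opens Y) :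
    appLE f U ((Opens.map f.base).obj U) le_rfl = f.c.app (op U) := by
  simp only [appLE]
  exact (congrArg _ (X.presheaf.map_id _)).trans (Category.comp_id _)

lemma appLE_comp_apply (f : X ⟶ Y) (g : Y ⟶ Z) (U : Opens Z) (V : Opens Y) (W : Opens X)
    (h₁ : V ≤ (Opens.map g.base).obj U) (h₂ : W ≤ (Opens.map f.base).obj V)
    (s : Z.presheaf.obj (op U)) :
    appLE f V W h₂ (appLE g U V h₁ s) =
      appLE (f ≫ g) U W (h₂.trans ((Opens.map f.base).map (homOfLE h₁)).le) s := by
  suffices appLE g U V h₁ ≫ appLE f V W h₂ = appLE (f ≫ g) U W _ from congr($this s)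
  simp only [appLE, Category.assoc, NatTrans.naturality_assoc, comp_c_app]
  exact congr(g.c.app _ ≫ f.c.app _ ≫ $((X.presheaf.map_comp _ _).symm)).trans
    (Category.assoc _ _ _).symm

lemma appLE_congr {f g : X ⟶ Y} (h : f = g) (U : Opens Y)
    (V : Opens X) (h₁ : V ≤ (Opens.map f.base).obj U) : appLE f U V h₁ = appLE g U V (h ▸ h₁) := by
  subst h; rfl

lemma appLE_bijective (f : X ⟶ Y) [IsOpenImmersion f] (U : Opens Y)
    (V : Opens X) (h : V = (Opens.map f.base).obj U) (hU : (U : Set Y) ⊆ Set.range f.base) :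
    Function.Bijective (appLE f U V h.le) := by
  subst h
  rw [appLE_self]
  have := IsOpenImmersion.isIso_of_subset f U hU
  exact ConcreteCategory.bijective_of_isIso _

end AppLE

namespace IsGluing

variable {W X Y P W' X' Y' P' : PresheafedSpace.{u, u + 1, u} CommRingCat.{u}}
  {a : W ⟶ X} {b : W ⟶ Y} {i : X ⟶ P} {j : Y ⟶ P}
  {a' : W' ⟶ X'} {b' : W' ⟶ Y'} {i' : X' ⟶ P'} {j' : Y' ⟶ P'}

lemma flip (h : IsGluing a b i j) : IsGluing b a j i where
  w := h.w.symm
  surj p := (h.surj p).symm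
  isClosedEmbedding_left := h.isClosedEmbedding_right
  isClosedEmbedding_right := h.isClosedEmbedding_left
  exists_of_eq x y hxy := by
    obtain ⟨z, hz, hz'⟩ := h.exists_of_eq y x hxy.symm
    exact ⟨z, hz', hz⟩
  section_ext U s t h₁ h₂ := h.section_ext U s t h₂ h₁
  section_exists U V hV ha hb s t hst := by
    have hw (x) : i.base (a.base x) = j.base (b.base x) := congr($(h.w).base x)
    obtain ⟨r, hr⟩ := h.section_exists U V
      (fun x (hx : i.base (a.base x) ∈ U) ↦ hV ((hw x).subst (motive := (· ∈ U)) hx)) hb ha t s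
      hst.symm
    exact ⟨r, hr.symm⟩

lemma appLE_ext (h : IsGluing a b i j) {U : Opens P} {A : Opens X} {B : Opens Y}
    (hA : A = (Opens.map i.base).obj U) (hB : B = (Opens.map j.base).obj U)
    {s t : P.presheaf.obj (op U)} (h₁ : appLE i U A hA.le s = appLE i U A hA.le t)
    (h₂ : appLE j U B hB.le s = appLE j U B hB.le t) : s = t := by
  subst hA hB
  rw [appLE_self] at h₁ h₂
  exact h.section_ext U s t h₁ h₂

lemma exists_appLE (h : IsGluing a b i j) {U : Opens P} {A : Opens X} {B : Opens Y} {C : Opens W}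
    (hA : A = (Opens.map i.base).obj U) (hB : B = (Opens.map j.base).obj U)
    (ha : C = (Opens.map a.base).obj A) (hb : C = (Opens.map b.base).obj B)
    (s : X.presheaf.obj (op A)) (t : Y.presheaf.obj (op B))
    (hst : appLE a A C ha.le s = appLE b B C hb.le t) :
    ∃ r, appLE i U A hA.le r = s ∧ appLE j U B hB.le r = t := by
  subst hA hB
  rw [appLE_self, appLE_self]
  exact h.section_exists U C ha.ge ha.le hb.le s t hst

lemma isOpen_of_preimage (h : IsGluing a b i j) {Z : Set P} (h₁ : IsOpen (i.base ⁻¹' Z))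
    (h₂ : IsOpen (j.base ⁻¹' Z)) : IsOpen Z := by
  rw [← isClosed_compl_iff] at h₁ h₂ ⊢
  convert (h.isClosedEmbedding_left.isClosedMap _ h₁).union
    (h.isClosedEmbedding_right.isClosedMap _ h₂) using 1
  ext p
  constructor
  · intro hp
    obtain ⟨x, rfl⟩ | ⟨x, rfl⟩ := h.surj p
    · exact .inl ⟨x, hp, rfl⟩
    · exact .inr ⟨x, hp, rfl⟩
  · rintro (⟨x, hx, rfl⟩ | ⟨x, hx, rfl⟩) <;> exact hx

/-- If `Y'` meets `W` inside the image of `W'`, then a point of `X` lying in the image of `V ⊆ P'`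
already comes from a point of `X'` lying in `V`. -/
lemma preimage_image_eq (h : IsGluing a b i j) (h' : IsGluing a' b' i' j')
    {f : X' ⟶ X} {g : W' ⟶ W} {k : Y' ⟶ Y} {φ : P' ⟶ P}
    (hk : Function.Injective k.base)
    (ea : a' ≫ f = g ≫ a) (eb : b' ≫ k = g ≫ b) (ei : i' ≫ φ = f ≫ i) (ej : j' ≫ φ = k ≫ j)
    (hb : ∀ w, b.base w ∈ Set.range k.base → w ∈ Set.range g.base) (V : Set P') :
    i.base ⁻¹' (φ.base '' V) = f.base '' (i'.base ⁻¹' V) := by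
  have ea' (x) : f.base (a'.base x) = a.base (g.base x) := congr($(ea).base x)
  have eb' (x) : k.base (b'.base x) = b.base (g.base x) := congr($(eb).base x)
  have ei' (x) : φ.base (i'.base x) = i.base (f.base x) := congr($(ei).base x)
  have ej' (x) : φ.base (j'.base x) = j.base (k.base x) := congr($(ej).base x)
  ext x
  constructor
  · rintro ⟨p, hp, hpx⟩
    obtain ⟨x', rfl⟩ | ⟨y', rfl⟩ := h'.surj p
    · exact ⟨x', hp, h.isClosedEmbedding_left.injective ((ei' _).symm.trans hpx)⟩
    · obtain ⟨w, rfl, hw⟩ := h.exists_of_eq x (k.base y') (hpx.symm.trans (ej' _))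
      obtain ⟨w, rfl⟩ := hb w ⟨_, hw.symm⟩
      refine ⟨a'.base w, ?_, ea' w⟩
      have : b'.base w = y' := hk ((eb' _).trans hw)
      have hw' : i'.base (a'.base w) = j'.base (b'.base w) := congr($(h'.w).base w)
      change i'.base (a'.base w) ∈ V
      rwa [hw', this]
  · rintro ⟨x', hx', rfl⟩
    exact ⟨i'.base x', hx', ei' x'⟩

/-- Given a gluing of `X` and `Y` along `W` and open subspaces `X'` and `Y'` of `X` and `Y` having
the same trace `W'` on `W`, a gluing of `X'` and `Y'` along `W'` is open in that of `X` and `Y`. -/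
theorem isOpenImmersion (h : IsGluing a b i j) (h' : IsGluing a' b' i' j')
    {f : X' ⟶ X} {g : W' ⟶ W} {k : Y' ⟶ Y} {φ : P' ⟶ P}
    [IsOpenImmersion f] [IsOpenImmersion g] [IsOpenImmersion k]
    (ea : a' ≫ f = g ≫ a) (eb : b' ≫ k = g ≫ b) (ei : i' ≫ φ = f ≫ i) (ej : j' ≫ φ = k ≫ j)
    (ha : ∀ w, a.base w ∈ Set.range f.base → w ∈ Set.range g.base)
    (hb : ∀ w, b.base w ∈ Set.range k.base → w ∈ Set.range g.base) :
    IsOpenImmersion φ := by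
  have of := IsOpenImmersion.base_open (f := f)
  have og := IsOpenImmersion.base_open (f := g)
  have ok := IsOpenImmersion.base_open (f := k)
  have hi := h.preimage_image_eq h' ok.injective ea eb ei ej hb
  have hj := h.flip.preimage_image_eq h'.flip of.injective eb ea ej ei ha
  have ea' (x) : f.base (a'.base x) = a.base (g.base x) := congr($(ea).base x)
  have eb' (x) : k.base (b'.base x) = b.base (g.base x) := congr($(eb).base x)
  have ei' (x) : φ.base (i'.base x) = i.base (f.base x) := congr($(ei).base x)
  have ej' (x) : φ.base (j'.base x) = j.base (k.base x) := congr($(ej).base x)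
  have hinj : Function.Injective φ.base := by
    intro p q hpq
    obtain ⟨x, rfl⟩ | ⟨y, rfl⟩ := h'.surj p
    · have : f.base x ∈ i.base ⁻¹' (φ.base '' {q}) := ⟨q, rfl, hpq.symm.trans (ei' x)⟩
      rw [hi] at this
      obtain ⟨x', hx', hxx'⟩ := this
      rwa [← of.injective hxx']
    · have : k.base y ∈ j.base ⁻¹' (φ.base '' {q}) := ⟨q, rfl, hpq.symm.trans (ej' y)⟩
      rw [hj] at this
      obtain ⟨x', hx', hxx'⟩ := this
      rwa [← ok.injective hxx']
  have hopen : IsOpenMap φ.base := fun V hV ↦ h.isOpen_of_preimage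
    (by rw [hi]; exact of.isOpenMap _ (hV.preimage i'.base.hom.2))
    (by rw [hj]; exact ok.isOpenMap _ (hV.preimage j'.base.hom.2))
  have base_open : Topology.IsOpenEmbedding φ.base :=
    .of_continuous_injective_isOpenMap φ.base.hom.2 hinj hopen
  refine ⟨base_open, fun U ↦ ?_⟩
  let V : Opens P := base_open.isOpenMap.functor.obj U
  have hVr : (V : Set P) ⊆ Set.range φ.base := Set.image_subset_range _ _
  have hVi : ((Opens.map i.base).obj V : Set X) ⊆ Set.range f.base :=
    (hi U).le.trans (Set.image_subset_range _ _)
  have hVj : ((Opens.map j.base).obj V : Set Y) ⊆ Set.range k.base :=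
    (hj U).le.trans (Set.image_subset_range _ _)
  have hVg : ((Opens.map a.base).obj ((Opens.map i.base).obj V) : Set W) ⊆ Set.range g.base :=
    fun w hw ↦ ha w (hVi hw)
  let A : Opens X := (Opens.map i.base).obj V
  let B : Opens Y := (Opens.map j.base).obj V
  let C : Opens W := (Opens.map a.base).obj A
  have hCb : C = (Opens.map b.base).obj B := by
    ext w; exact iff_of_eq (congrArg (· ∈ V) congr($(h.w).base w))
  let U' : Opens P' := (Opens.map φ.base).obj V
  let A' : Opens X' := (Opens.map f.base).obj A
  let B' : Opens Y' := (Opens.map k.base).obj B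
  let C' : Opens W' := (Opens.map g.base).obj C
  have hA' : A' = (Opens.map i'.base).obj U' := by
    ext x; exact iff_of_eq (congrArg (· ∈ V) (ei' x).symm)
  have hB' : B' = (Opens.map j'.base).obj U' := by
    ext x; exact iff_of_eq (congrArg (· ∈ V) (ej' x).symm)
  have hCa' : C' = (Opens.map a'.base).obj A' := by
    ext x; exact iff_of_eq (congrArg (· ∈ A) (ea' x).symm)
  have hCb' : C' = (Opens.map b'.base).obj B' := by
    ext x
    change g.base x ∈ C ↔ _
    rw [hCb]
    exact iff_of_eq (congrArg (· ∈ B) (eb' x).symm)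
  have bf := appLE_bijective f A A' rfl hVi
  have bk := appLE_bijective k B B' rfl hVj
  have bg := appLE_bijective g C C' rfl hVg
  have key₁ (s) : appLE i' U' A' hA'.le (appLE φ V U' le_rfl s) =
      appLE f A A' le_rfl (appLE i V A le_rfl s) := by
    rw [appLE_comp_apply, appLE_comp_apply, appLE_congr ei]
  have key₂ (s) : appLE j' U' B' hB'.le (appLE φ V U' le_rfl s) =
      appLE k B B' le_rfl (appLE j V B le_rfl s) := by
    rw [appLE_comp_apply, appLE_comp_apply, appLE_congr ej]
  suffices Function.Bijective (appLE φ V U' le_rfl) by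
    rw [appLE_self] at this
    exact ConcreteCategory.isIso_iff_bijective _ |>.mpr this
  constructor
  · intro s t hst
    refine h.appLE_ext (A := A) (B := B) rfl rfl (bf.1 ?_) (bk.1 ?_)
    · rw [← key₁, ← key₁, hst]
    · rw [← key₂, ← key₂, hst]
  · intro r'
    obtain ⟨s, hs⟩ := bf.2 (appLE i' U' A' hA'.le r')
    obtain ⟨t, ht⟩ := bk.2 (appLE j' U' B' hB'.le r')
    obtain ⟨r, hr₁, hr₂⟩ := h.exists_appLE (A := A) (B := B) (C := C) rfl rfl rfl hCb s t (bg.1 (by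
      rw [appLE_comp_apply, appLE_comp_apply, ← appLE_congr ea, ← appLE_congr eb,
        ← appLE_comp_apply a' f A A' C' le_rfl hCa'.le,
        ← appLE_comp_apply b' k B B' C' le_rfl hCb'.le, hs, ht,
        appLE_comp_apply, appLE_comp_apply, appLE_congr h'.w]
      all_goals first | exact hCa'.le | exact hCb'.le))
    refine ⟨r, h'.appLE_ext hA' hB' ?_ ?_⟩
    · rw [key₁, hr₁, hs]
    · rw [key₂, hr₂, ht]

lemma exists_opens (h : IsGluing a b i j) (A : Opens X) (B : Opens Y)
    (hAB : (Opens.map a.base).obj A = (Opens.map b.base).obj B) :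
    ∃ U : Opens P, A = (Opens.map i.base).obj U ∧ B = (Opens.map j.base).obj U := by
  have hA : i.base ⁻¹' (i.base '' A ∪ j.base '' B) = A := by
    ext x
    refine ⟨?_, fun hx ↦ .inl ⟨x, hx, rfl⟩⟩
    rintro (⟨x₁, hx₁, hx⟩ | ⟨y, hy, hx⟩)
    · rwa [← h.isClosedEmbedding_left.injective hx]
    · obtain ⟨w, rfl, rfl⟩ := h.exists_of_eq _ _ hx.symm
      exact hAB.ge hy
  have hB : j.base ⁻¹' (i.base '' A ∪ j.base '' B) = B := by
    ext y
    refine ⟨?_, fun hy ↦ .inr ⟨y, hy, rfl⟩⟩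
    rintro (⟨x, hx, hy⟩ | ⟨y₁, hy₁, hy⟩)
    · obtain ⟨w, rfl, rfl⟩ := h.exists_of_eq _ _ hy
      exact hAB.le hx
    · rwa [← h.isClosedEmbedding_right.injective hy]
  refine ⟨⟨i.base '' A ∪ j.base '' B, h.isOpen_of_preimage ?_ ?_⟩, Opens.ext hA.symm,
    Opens.ext hB.symm⟩
  · rw [hA]
    exact A.2
  · rw [hB]
    exact B.2

lemma isClosedEmbedding (h : IsGluing a b i j) (h' : IsGluing a' b' i' j')
    {f : X' ⟶ X} {g : W' ⟶ W} {k : Y' ⟶ Y} {φ : P' ⟶ P}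
    (hf : Topology.IsClosedEmbedding f.base) (hk : Topology.IsClosedEmbedding k.base)
    (eb : b' ≫ k = g ≫ b) (ei : i' ≫ φ = f ≫ i) (ej : j' ≫ φ = k ≫ j)
    (hpb : ∀ x w, f.base x = a.base w → ∃ v, a'.base v = x ∧ g.base v = w) :
    Topology.IsClosedEmbedding φ.base := by
  have eb' (x) : k.base (b'.base x) = b.base (g.base x) := congr($(eb).base x)
  have ei' (x) : φ.base (i'.base x) = i.base (f.base x) := congr($(ei).base x)
  have ej' (x) : φ.base (j'.base x) = j.base (k.base x) := congr($(ej).base x)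
  have key (x y) (hxy : φ.base (i'.base x) = φ.base (j'.base y)) : i'.base x = j'.base y := by
    rw [ei', ej'] at hxy
    obtain ⟨w, hw, hw'⟩ := h.exists_of_eq _ _ hxy
    obtain ⟨v, rfl, rfl⟩ := hpb x w hw.symm
    rw [← hk.injective ((eb' v).trans hw')]
    exact congr($(h'.w).base v)
  refine .of_continuous_injective_isClosedMap φ.base.hom.2 (fun p q hpq ↦ ?_) fun Z hZ ↦ ?_
  · obtain ⟨x, rfl⟩ | ⟨y, rfl⟩ := h'.surj p <;> obtain ⟨x₁, rfl⟩ | ⟨y₁, rfl⟩ := h'.surj q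
    · rw [ei', ei'] at hpq
      rw [hf.injective (h.isClosedEmbedding_left.injective hpq)]
    · exact key _ _ hpq
    · exact (key _ _ hpq.symm).symm
    · rw [ej', ej'] at hpq
      rw [hk.injective (h.isClosedEmbedding_right.injective hpq)]
  · convert ((h.isClosedEmbedding_left.comp hf).isClosedMap _ (hZ.preimage i'.base.hom.2)).union
      ((h.isClosedEmbedding_right.comp hk).isClosedMap _ (hZ.preimage j'.base.hom.2)) using 1
    ext p
    constructor
    · rintro ⟨q, hq, rfl⟩
      obtain ⟨x, rfl⟩ | ⟨y, rfl⟩ := h'.surj q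
      · exact .inl ⟨x, hq, (ei' x).symm⟩
      · exact .inr ⟨y, hq, (ej' y).symm⟩
    · rintro (⟨x, hx, rfl⟩ | ⟨y, hy, rfl⟩)
      · exact ⟨_, hx, ei' x⟩
      · exact ⟨_, hy, ej' y⟩

/-- Sections lift from `P'` to `P` if they do from `X'` to `X` and from `Y'` to `Y`, and if
moreover sections of `W` vanishing on `W'` extend to sections of `X` vanishing on `X'`. -/
lemma appLE_surjective (h : IsGluing a b i j) (h' : IsGluing a' b' i' j')
    {f : X' ⟶ X} {g : W' ⟶ W} {k : Y' ⟶ Y} {φ : P' ⟶ P}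
    (ea : a' ≫ f = g ≫ a) (eb : b' ≫ k = g ≫ b) (ei : i' ≫ φ = f ≫ i) (ej : j' ≫ φ = k ≫ j)
    {U : Opens P} {A : Opens X} {B : Opens Y} {C : Opens W}
    (hA : A = (Opens.map i.base).obj U) (hB : B = (Opens.map j.base).obj U)
    (ha : C = (Opens.map a.base).obj A) (hb : C = (Opens.map b.base).obj B)
    (hf : Function.Surjective (appLE f A _ le_rfl)) (hk : Function.Surjective (appLE k B _ le_rfl))
    (hC : ∀ t, appLE g C _ le_rfl t = 0 → ∃ s, appLE a A C ha.le s = t ∧ appLE f A _ le_rfl s = 0) :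
    Function.Surjective (appLE φ U _ le_rfl) := by
  have ea' (x) : f.base (a'.base x) = a.base (g.base x) := congr($(ea).base x)
  have eb' (x) : k.base (b'.base x) = b.base (g.base x) := congr($(eb).base x)
  have ei' (x) : φ.base (i'.base x) = i.base (f.base x) := congr($(ei).base x)
  have ej' (x) : φ.base (j'.base x) = j.base (k.base x) := congr($(ej).base x)
  let U' : Opens P' := (Opens.map φ.base).obj U
  let A' : Opens X' := (Opens.map f.base).obj A
  let B' : Opens Y' := (Opens.map k.base).obj B
  let C' : Opens W' := (Opens.map g.base).obj C
  have hA' : A' = (Opens.map i'.base).obj U' := by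
    ext x
    change f.base x ∈ A ↔ φ.base (i'.base x) ∈ U
    rw [ei', hA]; rfl
  have hB' : B' = (Opens.map j'.base).obj U' := by
    ext x
    change k.base x ∈ B ↔ φ.base (j'.base x) ∈ U
    rw [ej', hB]; rfl
  have hCa' : C' = (Opens.map a'.base).obj A' := by
    ext x
    change g.base x ∈ C ↔ f.base (a'.base x) ∈ A
    rw [ea', ha]; rfl
  have hCb' : C' = (Opens.map b'.base).obj B' := by
    ext x
    change g.base x ∈ C ↔ k.base (b'.base x) ∈ B
    rw [eb', hb]; rfl
  intro r'
  obtain ⟨s, hs⟩ := hf (appLE i' U' A' hA'.le r')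
  obtain ⟨t, ht⟩ := hk (appLE j' U' B' hB'.le r')
  obtain ⟨s₀, hs₀, hs₀'⟩ := hC (appLE a A C ha.le s - appLE b B C hb.le t) (by
    rw [map_sub, sub_eq_zero, appLE_comp_apply, appLE_comp_apply, ← appLE_congr ea,
      ← appLE_congr eb, ← appLE_comp_apply a' f A A' C' le_rfl hCa'.le,
      ← appLE_comp_apply b' k B B' C' le_rfl hCb'.le, hs, ht, appLE_comp_apply, appLE_comp_apply,
      appLE_congr h'.w]
    all_goals first | exact hCa'.le | exact hCb'.le)
  obtain ⟨r, hr₁, hr₂⟩ := h.exists_appLE hA hB ha hb (s - s₀) t (by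
    rw [map_sub, hs₀, sub_sub_cancel])
  refine ⟨r, h'.appLE_ext hA' hB' ?_ ?_⟩
  · rw [← hs, appLE_comp_apply, appLE_congr ei, ← appLE_comp_apply f i U A A' hA.le le_rfl, hr₁,
      map_sub, hs₀', sub_zero]
  · rw [← ht, appLE_comp_apply, appLE_congr ej, ← appLE_comp_apply k j U B B' hB.le le_rfl, hr₂]

end IsGluing

end AlgebraicGeometry.PresheafedSpace

namespace AlgebraicGeometry

open TopologicalSpace Opposite

section FiberProduct

lemma exists_of_isPullback {R A B C : CommRingCat.{u}} {f : A ⟶ R} {g : B ⟶ R} {p : C ⟶ A}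
    {q : C ⟶ B} (h : IsPullback p q f g) {x : A} {y : B} (hxy : f x = g y) :
    ∃ z, p z = x ∧ q z = y := by
  obtain ⟨z, hz⟩ :=
    (Types.isPullback_iff _ _ _ _).mp (h.map (CategoryTheory.forget CommRingCat)) |>.2.2 x y hxy
  exact ⟨z, hz⟩

lemma ext_of_isPullback {R A B C : CommRingCat.{u}} {f : A ⟶ R} {g : B ⟶ R} {p : C ⟶ A}
    {q : C ⟶ B} (h : IsPullback p q f g) {x y : C} (h₁ : p x = p y) (h₂ : q x = q y) : x = y :=
  (Types.isPullback_iff _ _ _ _).mp (h.map (CategoryTheory.forget CommRingCat)) |>.2.1 x y ⟨h₁, h₂⟩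

lemma Spec_map_appLE_algebraMap {R S : CommRingCat.{u}} (f : R ⟶ S) (U : (Spec R).Opens)
    (V : (Spec S).Opens) (h : V ≤ Spec.map f ⁻¹ᵁ U) (r : R) :
    (Spec.map f).appLE U V h (algebraMap R Γ(Spec R, U) r) = algebraMap S Γ(Spec S, V) (f r) := by
  rw [IsAffineOpen.algebraMap_Spec_obj, IsAffineOpen.algebraMap_Spec_obj]
  suffices ((Scheme.ΓSpecIso R).inv ≫ (Spec R).presheaf.map (homOfLE le_top).op) ≫
    (Spec.map f).appLE U V h =
      f ≫ (Scheme.ΓSpecIso S).inv ≫ (Spec S).presheaf.map (homOfLE le_top).op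
    from congr($this r)
  simp [Scheme.Hom.appLE, Scheme.ΓSpecIso_inv_naturality_assoc, ← Functor.map_comp]
  rfl

section Localization

variable {A B C R A' B' C' R' : Type*} [CommRing A] [CommRing B] [CommRing C] [CommRing R]
  [CommRing A'] [CommRing B'] [CommRing C'] [CommRing R'] [Algebra A A'] [Algebra B B']
  [Algebra C C'] [Algebra R R'] {f : A →+* R} {g : B →+* R} {p : C →+* A} {q : C →+* B}
  {f' : A' →+* R'} {g' : B' →+* R'} {p' : C' →+* A'} {q' : C' →+* B'}

lemma localization_ext_of_fiberProduct (c : C) [IsLocalization.Away c C']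
    [IsLocalization.Away (p c) A'] [IsLocalization.Away (q c) B']
    (hp : ∀ x, p' (algebraMap C C' x) = algebraMap A A' (p x))
    (hq : ∀ x, q' (algebraMap C C' x) = algebraMap B B' (q x))
    (ext : ∀ x y, p x = p y → q x = q y → x = y) {s t : C'} (h₁ : p' s = p' t)
    (h₂ : q' s = q' t) : s = t := by
  rw [← sub_eq_zero] at h₁ h₂ ⊢
  rw [← map_sub] at h₁ h₂
  generalize s - t = s at *
  obtain ⟨n, x, hx⟩ := IsLocalization.Away.surj c s
  have hpx : algebraMap A A' (p x) = algebraMap A A' 0 := by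
    rw [← hp, ← hx, map_mul, h₁, zero_mul, map_zero]
  have hqx : algebraMap B B' (q x) = algebraMap B B' 0 := by
    rw [← hq, ← hx, map_mul, h₂, zero_mul, map_zero]
  obtain ⟨m, hm⟩ := IsLocalization.Away.exists_of_eq (p c) hpx
  obtain ⟨k, hk⟩ := IsLocalization.Away.exists_of_eq (q c) hqx
  have : c ^ (m + k) * x = 0 := by
    apply ext
    · rw [map_mul, map_pow, add_comm, pow_add, mul_assoc, hm]; simp
    · rw [map_mul, map_pow, pow_add, mul_assoc, hk]; simp
  have hu := IsLocalization.Away.algebraMap_isUnit (S := C') c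
  refine (hu.pow n).mul_left_injective ?_
  refine (hu.pow (m + k)).mul_right_injective ?_
  simp only [zero_mul, mul_zero, hx]
  rw [← map_pow, ← map_mul, this, map_zero]

lemma exists_localization_of_fiberProduct (c : C) [IsLocalization.Away c C']
    [IsLocalization.Away (p c) A'] [IsLocalization.Away (q c) B']
    [IsLocalization.Away (f (p c)) R']
    (hf : ∀ x, f' (algebraMap A A' x) = algebraMap R R' (f x))
    (hg : ∀ x, g' (algebraMap B B' x) = algebraMap R R' (g x))
    (hp : ∀ x, p' (algebraMap C C' x) = algebraMap A A' (p x))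
    (hq : ∀ x, q' (algebraMap C C' x) = algebraMap B B' (q x))
    (w : ∀ x, f (p x) = g (q x))
    (ex : ∀ x y, f x = g y → ∃ z, p z = x ∧ q z = y) {s : A'} {t : B'} (h : f' s = g' t) :
    ∃ r, p' r = s ∧ q' r = t := by
  obtain ⟨n, x, hx⟩ := IsLocalization.Away.surj (p c) s
  obtain ⟨m, y, hy⟩ := IsLocalization.Away.surj (q c) t
  have : algebraMap R R' (f (p c ^ m * x)) = algebraMap R R' (g (q c ^ n * y)) := by
    rw [← hf, ← hg, map_mul, map_mul, ← hx, map_mul, map_mul (algebraMap B B'), ← hy,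
      map_mul g', map_mul g', h]
    simp only [map_pow, hf, hg, w]
    ring
  obtain ⟨k, hk⟩ := IsLocalization.Away.exists_of_eq (f (p c)) this
  obtain ⟨z, hz₁, hz₂⟩ := ex (p c ^ k * (p c ^ m * x)) (q c ^ k * (q c ^ n * y)) (by
    rw [map_mul, map_pow, hk, map_mul g (q c ^ k), map_pow, w])
  have hu := IsLocalization.Away.algebraMap_isUnit (S := C') c
  obtain ⟨d, hd⟩ := (hu.pow (k + n + m)).exists_right_inv
  have hd₁ : algebraMap A A' (p c) ^ (k + n + m) * p' d = 1 := by
    rw [← hp, ← map_pow, ← map_mul, hd, map_one]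
  have hd₂ : algebraMap B B' (q c) ^ (k + n + m) * q' d = 1 := by
    rw [← hq, ← map_pow, ← map_mul, hd, map_one]
  refine ⟨algebraMap C C' z * d, ?_, ?_⟩
  · rw [map_mul, hp, hz₁, map_mul, map_mul, ← hx, map_pow, map_pow]
    linear_combination s * hd₁
  · rw [map_mul, hq, hz₂, map_mul, map_mul, ← hy, map_pow, map_pow]
    linear_combination t * hd₂

end Localization

end FiberProduct

section Spec

variable {R A B C : CommRingCat.{u}} {f : A ⟶ R} {g : B ⟶ R} {p : C ⟶ A} {q : C ⟶ B}

lemma mem_range_Spec_map_iff (hp : Function.Surjective p) (z : Spec C) :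
    z ∈ Set.range (Spec.map p).base ↔ ∀ c, p c = 0 → c ∈ z.asIdeal := by
  have hp' : Set.range (Spec.map p).base = _ := range_comap_of_surjective _ p.hom hp
  rw [hp']
  rfl

lemma mem_range_or_mem_range_of_isPullback (h : IsPullback p q f g)
    (hp : Function.Surjective p) (hq : Function.Surjective q) (z : Spec C) :
    z ∈ Set.range (Spec.map p).base ∨ z ∈ Set.range (Spec.map q).base := by
  rw [mem_range_Spec_map_iff hp, mem_range_Spec_map_iff hq]
  by_contra! hz
  obtain ⟨⟨c, hc, hcz⟩, d, hd, hdz⟩ := hz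
  have : c * d = 0 := ext_of_isPullback h
    (by rw [map_mul, hc, zero_mul, map_zero])
    (by rw [map_mul, hd, mul_zero, map_zero])
  exact (z.2.mul_notMem hcz hdz) (this ▸ z.asIdeal.zero_mem)

lemma exists_Spec_map_eq_of_isPullback (h : IsPullback p q f g) (hf : Function.Surjective f)
    (hq : Function.Surjective q) (x : Spec A) (y : Spec B)
    (hxy : (Spec.map p).base x = (Spec.map q).base y) :
    ∃ w, (Spec.map f).base w = x ∧ (Spec.map g).base w = y := by
  have hx : x ∈ Set.range (Spec.map f).base := by
    rw [mem_range_Spec_map_iff hf]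
    intro s hs
    obtain ⟨c, rfl, hc⟩ := exists_of_isPullback h (x := s) (y := 0) (by rw [map_zero, hs])
    change c ∈ ((Spec.map p).base x).asIdeal
    rw [hxy]
    change q c ∈ y.asIdeal
    exact hc ▸ y.asIdeal.zero_mem
  obtain ⟨w, rfl⟩ := hx
  refine ⟨w, rfl, ?_⟩
  refine PrimeSpectrum.comap_injective_of_surjective q.hom hq ?_
  refine Eq.trans ?_ hxy
  change (Spec.map g ≫ Spec.map q).base w = (Spec.map f ≫ Spec.map p).base w
  rw [← Spec.map_comp, ← Spec.map_comp, h.w]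

/-- A gluing of `Spec A` and `Spec B` along a common closed subscheme `Spec R` is `Spec` of the
fibre product `A ×_R B`. -/
theorem isIso_of_isGluing_Spec (h : IsPullback p q f g) (hf : Function.Surjective f)
    (hg : Function.Surjective g) {P : LocallyRingedSpace.{u}}
    {i : (Spec A).toLocallyRingedSpace ⟶ P} {j : (Spec B).toLocallyRingedSpace ⟶ P}
    (hP : PresheafedSpace.IsGluing (Spec.map f).toLRSHom.toHom (Spec.map g).toLRSHom.toHom
      i.toHom j.toHom) (φ : P ⟶ (Spec C).toLocallyRingedSpace)
    (hi : i ≫ φ = (Spec.map p).toLRSHom) (hj : j ≫ φ = (Spec.map q).toLRSHom) : IsIso φ := by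
  have hp : Function.Surjective p := fun x ↦ by
    obtain ⟨y, hy⟩ := hg (f x)
    obtain ⟨z, hz, -⟩ := exists_of_isPullback h hy.symm
    exact ⟨z, hz⟩
  have hq : Function.Surjective q := fun y ↦ by
    obtain ⟨x, hx⟩ := hf (g y)
    obtain ⟨z, -, hz⟩ := exists_of_isPullback h hx
    exact ⟨z, hz⟩
  have hi' : i.toShHom.hom ≫ φ.toShHom.hom = (Spec.map p).toLRSHom.toHom := congr($(hi).toHom)
  have hj' : j.toShHom.hom ≫ φ.toShHom.hom = (Spec.map q).toLRSHom.toHom := congr($(hj).toHom)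
  have hip (x) : φ.base (i.base x) = (Spec.map p).base x := congr($(hi).base x)
  have hjq (x) : φ.base (j.base x) = (Spec.map q).base x := congr($(hj).base x)
  have hw (x) : i.base ((Spec.map f).base x) = j.base ((Spec.map g).base x) := congr($(hP.w).base x)
  have cp : Topology.IsClosedEmbedding (Spec.map p).base :=
    PrimeSpectrum.isClosedEmbedding_comap_of_surjective _ p.hom hp
  have cq : Topology.IsClosedEmbedding (Spec.map q).base :=
    PrimeSpectrum.isClosedEmbedding_comap_of_surjective _ q.hom hq
  have key (x y) (hxy : φ.base (i.base x) = φ.base (j.base y)) : i.base x = j.base y := by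
    rw [hip, hjq] at hxy
    obtain ⟨w, rfl, rfl⟩ := exists_Spec_map_eq_of_isPullback h hf hq x y hxy
    exact hw w
  have hinj : Function.Injective φ.base := by
    intro x y hxy
    obtain ⟨x, rfl⟩ | ⟨x, rfl⟩ := hP.surj x <;> obtain ⟨y, rfl⟩ | ⟨y, rfl⟩ := hP.surj y
    · exact congrArg _ (cp.injective ((hip x).symm.trans (hxy.trans (hip y))))
    · exact key x y hxy
    · exact (key y x hxy.symm).symm
    · exact congrArg _ (cq.injective ((hjq x).symm.trans (hxy.trans (hjq y))))
  have hsurj : Function.Surjective φ.base := by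
    intro z
    obtain ⟨x, rfl⟩ | ⟨x, rfl⟩ := mem_range_or_mem_range_of_isPullback h hp hq z
    · exact ⟨_, hip x⟩
    · exact ⟨_, hjq x⟩
  have hclosed : IsClosedMap φ.base := by
    intro Z hZ
    convert (cp.isClosedMap _ (hZ.preimage i.base.hom.2)).union
      (cq.isClosedMap _ (hZ.preimage j.base.hom.2)) using 1
    ext z
    constructor
    · rintro ⟨y, hy, rfl⟩
      obtain ⟨x, rfl⟩ | ⟨x, rfl⟩ := hP.surj y
      · exact .inl ⟨x, hy, (hip x).symm⟩
      · exact .inr ⟨x, hy, (hjq x).symm⟩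
    · rintro (⟨x, hx, rfl⟩ | ⟨x, hx, rfl⟩)
      · exact ⟨_, hx, hip x⟩
      · exact ⟨_, hx, hjq x⟩
  have hbase : IsIso φ.base :=
    TopCat.isIso_iff_isHomeomorph _ |>.mpr
      (isHomeomorph_iff_continuous_isClosedMap_bijective.mpr ⟨φ.base.hom.2, hclosed, hinj, hsurj⟩)
  let F : (Spec C).sheaf ⟶ (TopCat.Sheaf.pushforward _ φ.base).obj P.sheaf := ⟨φ.c⟩
  have : IsIso F := by
    refine TopCat.Sheaf.isIso_iff_isIso_basis PrimeSpectrum.isBasis_basic_opens fun c ↦ ?_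
    rw [ConcreteCategory.isIso_iff_bijective]
    let U : (Spec C).Opens := PrimeSpectrum.basicOpen c
    let UP : Opens P := (Opens.map φ.base).obj U
    let UA : (Spec A).Opens := PrimeSpectrum.basicOpen (p c)
    let UB : (Spec B).Opens := PrimeSpectrum.basicOpen (q c)
    let UR : (Spec R).Opens := PrimeSpectrum.basicOpen (f (p c))
    have hUR : UR = (Opens.map (Spec.map g).base).obj UB := by
      ext x
      have : f (p c) = g (q c) := congr($(h.w) c)
      exact not_congr (iff_of_eq congr($this ∈ x.asIdeal))
    have hUA : UA = (Opens.map i.base).obj UP := by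
      ext x; exact iff_of_eq congr($((hip x).symm) ∈ U)
    have hUB : UB = (Opens.map j.base).obj UP := by
      ext x; exact iff_of_eq congr($((hjq x).symm) ∈ U)
    have h₁ (s) : (Spec.map p).appLE U UA le_rfl s =
        PresheafedSpace.appLE i.toHom UP UA hUA.le (φ.c.app (op U) s) := by
      have := PresheafedSpace.appLE_comp_apply i.toHom φ.toHom U UP UA le_rfl hUA.le s
      rw [PresheafedSpace.appLE_self] at this
      exact congr($(PresheafedSpace.appLE_congr hi'.symm U UA le_rfl) s).trans this.symm
    have h₂ (s) : (Spec.map q).appLE U UB le_rfl s =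
        PresheafedSpace.appLE j.toHom UP UB hUB.le (φ.c.app (op U) s) := by
      have := PresheafedSpace.appLE_comp_apply j.toHom φ.toHom U UP UB le_rfl hUB.le s
      rw [PresheafedSpace.appLE_self] at this
      exact congr($(PresheafedSpace.appLE_congr hj'.symm U UB le_rfl) s).trans this.symm
    have hp₀ := Spec_map_appLE_algebraMap p U UA le_rfl
    have hq₀ := Spec_map_appLE_algebraMap q U UB le_rfl
    have hf₀ := Spec_map_appLE_algebraMap f UA UR le_rfl
    have hg₀ := Spec_map_appLE_algebraMap g UB UR hUR.le
    have : IsLocalization.Away c Γ(Spec C, U) := inferInstance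
    have : IsLocalization.Away (p.hom c) Γ(Spec A, UA) := inferInstance
    have : IsLocalization.Away (q.hom c) Γ(Spec B, UB) := inferInstance
    have : IsLocalization.Away (f.hom (p.hom c)) Γ(Spec R, UR) := inferInstance
    constructor
    · intro s t hst
      refine localization_ext_of_fiberProduct c hp₀ hq₀ (fun x y ↦ ext_of_isPullback h)
        ((h₁ s).trans (.trans ?_ (h₁ t).symm)) ((h₂ s).trans (.trans ?_ (h₂ t).symm))
      · exact congrArg _ hst
      · exact congrArg _ hst
    · intro r
      obtain ⟨s, hs₁, hs₂⟩ := exists_localization_of_fiberProduct c hf₀ hg₀ hp₀ hq₀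
        (fun x ↦ congr($(h.w) x)) (fun x y ↦ exists_of_isPullback h)
        (s := PresheafedSpace.appLE i.toHom UP UA hUA.le r)
        (t := PresheafedSpace.appLE j.toHom UP UB hUB.le r) (by
          refine (PresheafedSpace.appLE_comp_apply (Spec.map f).toLRSHom.toHom i.toHom UP UA UR
            hUA.le le_rfl r).trans (.trans ?_ (PresheafedSpace.appLE_comp_apply
              (Spec.map g).toLRSHom.toHom j.toHom UP UB UR hUB.le hUR.le r).symm)
          rw [PresheafedSpace.appLE_congr hP.w])
      exact ⟨s, hP.appLE_ext hUA hUB ((h₁ s).symm.trans hs₁) ((h₂ s).symm.trans hs₂)⟩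
  have : IsIso φ.c := inferInstanceAs (IsIso ((TopCat.Sheaf.forget _ _).map F))
  have : IsIso φ.toHom := PresheafedSpace.isIso_of_components _
  have : IsIso (SheafedSpace.forgetToPresheafedSpace.map φ.toShHom) := ‹IsIso φ.toHom›
  have : IsIso (LocallyRingedSpace.forgetToSheafedSpace.map φ) :=
    isIso_of_reflects_iso φ.toShHom SheafedSpace.forgetToPresheafedSpace
  exact isIso_of_reflects_iso φ LocallyRingedSpace.forgetToSheafedSpace

end Spec

section Neighbourhoods

variable {W X Y : Scheme.{u}} (a : W ⟶ X) (b : W ⟶ Y) [IsClosedImmersion a] [IsClosedImmersion b]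

lemma exists_opens_preimage_eq (O : W.Opens) : ∃ U : X.Opens, a ⁻¹ᵁ U = O := by
  obtain ⟨U, hU, hUO⟩ := a.isClosedEmbedding.isInducing.isOpen_iff.mp O.2
  exact ⟨⟨U, hU⟩, Opens.ext hUO⟩

lemma appLE_surjective_of_isClosedImmersion {U : X.Opens} (hU : IsAffineOpen U) {O : W.Opens}
    (h : O = a ⁻¹ᵁ U) : Function.Surjective (a.appLE U O h.le) := by
  subst h
  rw [← Scheme.Hom.app_eq_appLE]
  exact a.app_surjective U hU

lemma exists_isAffineOpen_preimage_eq_preimage_of_mem {S : X.Opens} {T : Y.Opens} (w : W)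
    (hS : a.base w ∈ S) (hT : b.base w ∈ T) : ∃ U ≤ S, ∃ V ≤ T,
      IsAffineOpen U ∧ IsAffineOpen V ∧ a ⁻¹ᵁ U = b ⁻¹ᵁ V ∧ a.base w ∈ U := by
  obtain ⟨U₀, hU₀, hwU₀, hUS⟩ := exists_isAffineOpen_mem_and_subset hS
  obtain ⟨V, hV, hwV, hVT⟩ := exists_isAffineOpen_mem_and_subset hT
  obtain ⟨E, hE⟩ := exists_opens_preimage_eq a (b ⁻¹ᵁ V)
  have hwE : a.base w ∈ E := hE.ge hwV
  obtain ⟨f, hfE, hwf⟩ := hU₀.exists_basicOpen_le ⟨_, hwE⟩ hwU₀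
  obtain ⟨D, hD⟩ := exists_opens_preimage_eq b (a ⁻¹ᵁ X.basicOpen f)
  have hwD : b.base w ∈ D := hD.ge hwf
  obtain ⟨g, hgD, hwg⟩ := hV.exists_basicOpen_le ⟨_, hwD⟩ hwV
  have hUV : a ⁻¹ᵁ X.basicOpen f ≤ b ⁻¹ᵁ V := fun x hx ↦ hE.le (hfE hx)
  have hVU : b ⁻¹ᵁ Y.basicOpen g ≤ a ⁻¹ᵁ X.basicOpen f := fun x hx ↦ hD.le (hgD hx)
  obtain ⟨h, hh⟩ := a.app_surjective _ (hU₀.basicOpen f) (b.appLE V _ hUV g)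
  have heq : a ⁻¹ᵁ X.basicOpen h = b ⁻¹ᵁ Y.basicOpen g := by
    rw [Scheme.preimage_basicOpen, hh, Scheme.basicOpen_appLE, inf_eq_right.mpr hVU]
  exact ⟨_, (X.basicOpen_le h).trans ((X.basicOpen_le f).trans hUS), _,
    (Y.basicOpen_le g).trans hVT,
    (hU₀.basicOpen f).basicOpen h, hV.basicOpen g, heq, heq.ge hwg⟩

lemma exists_isAffineOpen_preimage_eq_preimage (x : X) {S : X.Opens} {T : Y.Opens}
    (hST : a ⁻¹ᵁ S ≤ b ⁻¹ᵁ T) (hx : x ∈ S) : ∃ U ≤ S, ∃ V ≤ T,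
      IsAffineOpen U ∧ IsAffineOpen V ∧ a ⁻¹ᵁ U = b ⁻¹ᵁ V ∧ x ∈ U := by
  by_cases hxa : x ∈ Set.range a.base
  · obtain ⟨w, rfl⟩ := hxa
    exact exists_isAffineOpen_preimage_eq_preimage_of_mem a b w hx (hST hx)
  · let E : X.Opens := ⟨(Set.range a.base)ᶜ, a.isClosedEmbedding.isClosed_range.isOpen_compl⟩
    obtain ⟨U, hU, hxU, hUT⟩ := exists_isAffineOpen_mem_and_subset (U := E ⊓ S) ⟨hxa, hx⟩
    refine ⟨U, fun _ h ↦ (hUT h).2, ⊥, bot_le, hU, isAffineOpen_bot Y, ?_, hxU⟩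
    ext w
    exact ⟨fun hw ↦ ((hUT hw).1 ⟨w, rfl⟩).elim, fun hw ↦ hw.elim⟩

end Neighbourhoods

section Pushout

lemma isGluing_of_isPushout {W X Y P : LocallyRingedSpace.{u}} {a : W ⟶ X} {b : W ⟶ Y}
    {i : X ⟶ P} {j : Y ⟶ P} (h : IsPushout a b i j) (ha : Topology.IsClosedEmbedding a.base)
    (hb : Topology.IsClosedEmbedding b.base) :
    PresheafedSpace.IsGluing a.toShHom.hom b.toShHom.hom i.toShHom.hom j.toShHom.hom :=
  .of_isPushout ((h.map LocallyRingedSpace.forgetToSheafedSpace).map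
    SheafedSpace.forgetToPresheafedSpace) ha hb

lemma exists_Spec_isOpenImmersion {W X Y : Scheme.{u}} (a : W ⟶ X) (b : W ⟶ Y)
    [IsClosedImmersion a] [IsClosedImmersion b] {P : LocallyRingedSpace.{u}}
    {i : X.toLocallyRingedSpace ⟶ P} {j : Y.toLocallyRingedSpace ⟶ P}
    (h : IsPushout a.toLRSHom b.toLRSHom i j) {U : X.Opens} {V : Y.Opens} (hU : IsAffineOpen U)
    (hV : IsAffineOpen V) (hUV : a ⁻¹ᵁ U = b ⁻¹ᵁ V) :
    ∃ (R : CommRingCat.{u}) (f : (Spec R).toLocallyRingedSpace ⟶ P),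
      LocallyRingedSpace.IsOpenImmersion f ∧ i.base '' U ⊆ Set.range f.base := by
  have hW : IsAffineOpen (a ⁻¹ᵁ U) := hU.preimage a
  let f := a.appLE U (a ⁻¹ᵁ U) le_rfl
  let g := b.appLE V (a ⁻¹ᵁ U) hUV.le
  have hf : Function.Surjective f := appLE_surjective_of_isClosedImmersion a hU rfl
  have hg : Function.Surjective g := appLE_surjective_of_isClosedImmersion b hV hUV
  have ef : Spec.map f ≫ hU.fromSpec = hW.fromSpec ≫ a :=
    IsAffineOpen.SpecMap_appLE_fromSpec ..
  have eg : Spec.map g ≫ hV.fromSpec = hW.fromSpec ≫ b :=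
    IsAffineOpen.SpecMap_appLE_fromSpec ..
  have cf := IsClosedImmersion.spec_of_surjective f hf
  have cg := IsClosedImmersion.spec_of_surjective g hg
  have hP := isGluing_of_isPushout h a.isClosedEmbedding b.isClosedEmbedding
  have h' := IsPushout.of_hasPushout (Spec.map f).toLRSHom (Spec.map g).toLRSHom
  have hP' := isGluing_of_isPushout h' (Spec.map f).isClosedEmbedding (Spec.map g).isClosedEmbedding
  have ef' : (Spec.map f).toLRSHom ≫ hU.fromSpec.toLRSHom = hW.fromSpec.toLRSHom ≫ a.toLRSHom :=
    congr($(ef).toLRSHom)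
  have eg' : (Spec.map g).toLRSHom ≫ hV.fromSpec.toLRSHom = hW.fromSpec.toLRSHom ≫ b.toLRSHom :=
    congr($(eg).toLRSHom)
  let ψ := h'.desc (hU.fromSpec.toLRSHom ≫ i) (hV.fromSpec.toLRSHom ≫ j) (by
    rw [reassoc_of% ef', reassoc_of% eg', h.w])
  have hψi : pushout.inl _ _ ≫ ψ = hU.fromSpec.toLRSHom ≫ i := h'.inl_desc _ _ _
  have hψj : pushout.inr _ _ ≫ ψ = hV.fromSpec.toLRSHom ≫ j := h'.inr_desc _ _ _
  have hψ : LocallyRingedSpace.IsOpenImmersion ψ := by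
    refine hP.isOpenImmersion hP' (f := hU.fromSpec.toLRSHom.toShHom.hom)
      (g := hW.fromSpec.toLRSHom.toShHom.hom) (k := hV.fromSpec.toLRSHom.toShHom.hom)
      congr($(ef').toShHom.hom) congr($(eg').toShHom.hom) congr($(hψi).toShHom.hom)
      congr($(hψj).toShHom.hom) (fun w hw ↦ ?_) (fun w hw ↦ ?_)
    · exact hW.range_fromSpec.ge (hU.range_fromSpec.le hw)
    · exact hW.range_fromSpec.ge (hUV.ge (hV.range_fromSpec.le hw))
  have hpb := IsPullback.of_hasPullback f g
  let φ := h'.desc (Spec.map (pullback.fst f g)).toLRSHom (Spec.map (pullback.snd f g)).toLRSHom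
    (congr($(show Spec.map f ≫ Spec.map _ = Spec.map g ≫ Spec.map _ by
      rw [← Spec.map_comp, ← Spec.map_comp, hpb.w]).toLRSHom))
  have hφ : IsIso φ := isIso_of_isGluing_Spec hpb hf hg hP' φ (h'.inl_desc _ _ _)
    (h'.inr_desc _ _ _)
  refine ⟨_, inv φ ≫ ψ, inferInstance, ?_⟩
  rintro _ ⟨x, hx, rfl⟩
  obtain ⟨x, rfl⟩ := hU.range_fromSpec.ge hx
  refine ⟨φ.base ((pushout.inl (Spec.map f).toLRSHom (Spec.map g).toLRSHom).base x), ?_⟩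
  have : φ ≫ inv φ ≫ ψ = ψ := IsIso.hom_inv_id_assoc _ _
  exact congr($(this).base _).trans congr($(hψi).base x)

lemma exists_isPushout_scheme {W X Y : Scheme.{u}} (a : W ⟶ X) (b : W ⟶ Y)
    [IsClosedImmersion a] [IsClosedImmersion b] : ∃ (Q : Scheme.{u}) (i : X ⟶ Q) (j : Y ⟶ Q),
      IsPushout a.toLRSHom b.toLRSHom i.toLRSHom j.toLRSHom := by
  have h := IsPushout.of_hasPushout a.toLRSHom b.toLRSHom
  have hP := isGluing_of_isPushout h a.isClosedEmbedding b.isClosedEmbedding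
  let Q : Scheme.{u} := LocallyRingedSpace.IsOpenImmersion.scheme
    (pushout a.toLRSHom b.toLRSHom) fun p ↦ by
      obtain ⟨x, rfl⟩ | ⟨y, rfl⟩ := hP.surj p
      · obtain ⟨U, -, V, -, hU, hV, hUV, hx⟩ := exists_isAffineOpen_preimage_eq_preimage a b x
          (S := ⊤) (T := ⊤) le_rfl trivial
        obtain ⟨R, f, hf, hfU⟩ := exists_Spec_isOpenImmersion a b h hU hV hUV
        exact ⟨R, f, hfU ⟨x, hx, rfl⟩, hf⟩
      · obtain ⟨V, -, U, -, hV, hU, hUV, hy⟩ := exists_isAffineOpen_preimage_eq_preimage b a y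
          (S := ⊤) (T := ⊤) le_rfl trivial
        obtain ⟨R, f, hf, hfV⟩ := exists_Spec_isOpenImmersion b a h.flip hV hU hUV
        exact ⟨R, f, hfV ⟨y, hy, rfl⟩, hf⟩
  exact ⟨Q, ⟨pushout.inl a.toLRSHom b.toLRSHom⟩, ⟨pushout.inr a.toLRSHom b.toLRSHom⟩, h⟩

/-- The pushout of schemes along two closed immersions is the gluing. -/
theorem isGluing_pushout {W X Y : Scheme.{u}} (a : W ⟶ X) (b : W ⟶ Y)
    [IsClosedImmersion a] [IsClosedImmersion b] [HasPushout a b] :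
    PresheafedSpace.IsGluing a.toLRSHom.toShHom.hom b.toLRSHom.toShHom.hom
      (pushout.inl a b).toLRSHom.toShHom.hom (pushout.inr a b).toLRSHom.toShHom.hom := by
  obtain ⟨Q, i, j, h⟩ := exists_isPushout_scheme a b
  have hQ : IsPushout a b i j := .of_map Scheme.forgetToLocallyRingedSpace
    (Scheme.forgetToLocallyRingedSpace.map_injective h.w) h
  have hG := isGluing_of_isPushout h a.isClosedEmbedding b.isClosedEmbedding
  let e := hQ.isoPushout.inv.toLRSHom.toShHom.hom
  have : IsIso e := inferInstanceAs (IsIso (SheafedSpace.forgetToPresheafedSpace.map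
    (LocallyRingedSpace.forgetToSheafedSpace.map
      (Scheme.forgetToLocallyRingedSpace.map hQ.isoPushout.inv))))
  refine .of_comp_isIso e ?_
  convert hG using 1
  · exact congr($(hQ.inl_isoPushout_inv).toLRSHom.toShHom.hom)
  · exact congr($(hQ.inr_isoPushout_inv).toLRSHom.toShHom.hom)

end Pushout

section ClosedImmersion

lemma exists_eq_of_isPushout {R S A B : CommRingCat.{u}} {f : R ⟶ S} {g : R ⟶ A} {f' : S ⟶ B}
    {g' : A ⟶ B} (h : IsPushout f g f' g') (hf : Function.Surjective f) (hg : Function.Surjective g)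
    (t : S) (ht : f' t = 0) : ∃ s, f s = t ∧ g s = 0 := by
  obtain ⟨r, rfl⟩ := hf t
  let I := RingHom.ker f.hom
  let J := RingHom.ker g.hom
  let q : R ⟶ CommRingCat.of (R ⧸ (I ⊔ J)) := CommRingCat.ofHom (Ideal.Quotient.mk (I ⊔ J))
  have hq (x) (hx : x ∈ I ⊔ J) : q x = 0 := Ideal.Quotient.eq_zero_iff_mem.mpr hx
  let u : S ⟶ CommRingCat.of (R ⧸ (I ⊔ J)) :=
    CommRingCat.ofHom (RingHom.liftOfSurjective f.hom hf
      ⟨q.hom, fun x hx ↦ hq x (Ideal.mem_sup_left hx)⟩)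
  let v : A ⟶ CommRingCat.of (R ⧸ (I ⊔ J)) :=
    CommRingCat.ofHom (RingHom.liftOfSurjective g.hom hg
      ⟨q.hom, fun x hx ↦ hq x (Ideal.mem_sup_right hx)⟩)
  have hu (x) : u (f x) = q x := RingHom.liftOfRightInverse_comp_apply ..
  have hv (x) : v (g x) = q x := RingHom.liftOfRightInverse_comp_apply ..
  have huv : f ≫ u = g ≫ v := by
    ext x
    exact (hu x).trans (hv x).symm
  have hr : q r = 0 := by
    rw [← hu, ← h.inl_desc u v huv, CommRingCat.comp_apply, ht, map_zero]
  obtain ⟨x, hx, y, hy, hxy⟩ := Submodule.mem_sup.mp (Ideal.Quotient.eq_zero_iff_mem.mp hr)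
  refine ⟨y, ?_, hy⟩
  rw [← hxy, map_add, show f x = 0 from hx, zero_add]

lemma exists_appLE_eq_of_isPullback {X Y Z T : Scheme.{u}} {p : T ⟶ Y} {q : T ⟶ Z} {f : Y ⟶ X}
    {g : Z ⟶ X} [IsClosedImmersion f] [IsClosedImmersion g] (h : IsPullback p q f g) {U : X.Opens}
    (hU : IsAffineOpen U) {C : Z.Opens} (hC : C = g ⁻¹ᵁ U) (t : Γ(Z, C))
    (ht : q.appLE C (q ⁻¹ᵁ C) le_rfl t = 0) :
    ∃ s : Γ(X, U), g.appLE U C hC.le s = t ∧ f.appLE U (f ⁻¹ᵁ U) le_rfl s = 0 := by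
  have hT : q ⁻¹ᵁ C = p ⁻¹ᵁ f ⁻¹ᵁ U ⊓ q ⁻¹ᵁ C := by
    subst hC
    rw [← Scheme.Hom.comp_preimage, ← h.w, Scheme.Hom.comp_preimage, inf_idem]
  have := isIso_pushoutSection_of_isAffineOpen h hC.le (le_refl (f ⁻¹ᵁ U)) hT hU
    (hC ▸ hU.preimage g) (hU.preimage f)
  exact exists_eq_of_isPushout ((isIso_pushoutSection_iff _ _ _ _).mp this).flip
    (appLE_surjective_of_isClosedImmersion g hU hC)
    (appLE_surjective_of_isClosedImmersion f hU rfl) t ht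

variable {W X Y P W' X' Y' P' : Scheme.{u}} {a : W ⟶ X} {b : W ⟶ Y} {i : X ⟶ P} {j : Y ⟶ P}
  {a' : W' ⟶ X'} {b' : W' ⟶ Y'} {i' : X' ⟶ P'} {j' : Y' ⟶ P'}

open PresheafedSpace in
theorem isClosedImmersion_of_isGluing [IsClosedImmersion a] [IsClosedImmersion b]
    (h : IsGluing a.toLRSHom.toShHom.hom b.toLRSHom.toShHom.hom i.toLRSHom.toShHom.hom
      j.toLRSHom.toShHom.hom)
    (h' : IsGluing a'.toLRSHom.toShHom.hom b'.toLRSHom.toShHom.hom i'.toLRSHom.toShHom.hom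
      j'.toLRSHom.toShHom.hom)
    {f : X' ⟶ X} {g : W' ⟶ W} {k : Y' ⟶ Y} {φ : P' ⟶ P}
    [IsClosedImmersion f] [IsClosedImmersion k] (hpb : IsPullback a' g f a)
    (eb : b' ≫ k = g ≫ b) (ei : i' ≫ φ = f ≫ i) (ej : j' ≫ φ = k ≫ j) :
    IsClosedImmersion φ := by
  have hφ : Topology.IsClosedEmbedding φ := h.isClosedEmbedding h' f.isClosedEmbedding
    k.isClosedEmbedding congr($(eb).toLRSHom.toShHom.hom) congr($(ei).toLRSHom.toShHom.hom)
    congr($(ej).toLRSHom.toShHom.hom) fun x w hxw ↦ Scheme.exists_preimage_of_isPullback hpb x w hxw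
  have hnhds (p : P) (O : P.Opens) (hp : p ∈ O) : ∃ U ≤ O, p ∈ U ∧
      Function.Surjective (φ.appLE U (φ ⁻¹ᵁ U) le_rfl) := by
    have hw : a ⁻¹ᵁ i ⁻¹ᵁ O = b ⁻¹ᵁ j ⁻¹ᵁ O := by
      ext w
      exact iff_of_eq (congrArg (· ∈ O) congr($(h.w).base w))
    obtain ⟨A, hAO, B, hBO, hA, hB, hAB, hpAB⟩ : ∃ A ≤ i ⁻¹ᵁ O, ∃ B ≤ j ⁻¹ᵁ O,
        IsAffineOpen A ∧ IsAffineOpen B ∧ a ⁻¹ᵁ A = b ⁻¹ᵁ B ∧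
          ((∃ x ∈ A, i.base x = p) ∨ ∃ y ∈ B, j.base y = p) := by
      obtain ⟨x, rfl⟩ | ⟨y, rfl⟩ := h.surj p
      · obtain ⟨A, hAO, B, hBO, hA, hB, hAB, hx⟩ :=
          exists_isAffineOpen_preimage_eq_preimage a b x hw.le hp
        exact ⟨A, hAO, B, hBO, hA, hB, hAB, .inl ⟨x, hx, rfl⟩⟩
      · obtain ⟨B, hBO, A, hAO, hB, hA, hAB, hy⟩ :=
          exists_isAffineOpen_preimage_eq_preimage b a y hw.ge hp
        exact ⟨A, hAO, B, hBO, hA, hB, hAB.symm, .inr ⟨y, hy, rfl⟩⟩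
    obtain ⟨U, hAU, hBU⟩ := h.exists_opens A B hAB
    refine ⟨U, fun q hq ↦ ?_, ?_, ?_⟩
    · obtain ⟨x, rfl⟩ | ⟨y, rfl⟩ := h.surj q
      · exact hAO (hAU.ge hq)
      · exact hBO (hBU.ge hq)
    · obtain ⟨x, hx, rfl⟩ | ⟨y, hy, rfl⟩ := hpAB
      · exact hAU.le hx
      · exact hBU.le hy
    · exact h.appLE_surjective h' congr($(hpb.w).toLRSHom.toShHom.hom)
        congr($(eb).toLRSHom.toShHom.hom) congr($(ei).toLRSHom.toShHom.hom)
        congr($(ej).toLRSHom.toShHom.hom) hAU hBU rfl hAB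
        (appLE_surjective_of_isClosedImmersion f hA rfl)
        (appLE_surjective_of_isClosedImmersion k hB rfl)
        (exists_appLE_eq_of_isPullback hpb hA rfl)
  refine { isClosedEmbedding := hφ, stalkMap_surjective := fun p t ↦ ?_ }
  obtain ⟨V, hp, s, rfl⟩ := P'.presheaf.exists_germ_eq t
  obtain ⟨O, hO, hOV⟩ := hφ.isInducing.isOpen_iff.mp V.2
  obtain ⟨U, hUO, hpU, hU⟩ := hnhds (φ p) ⟨O, hO⟩ (hOV.ge hp)
  have hUV : φ ⁻¹ᵁ U ≤ V := fun q hq ↦ hOV.le (hUO hq)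
  obtain ⟨r, hr⟩ := hU (P'.presheaf.map (homOfLE hUV).op s)
  refine ⟨P.presheaf.germ U _ hpU r, ?_⟩
  rw [Scheme.Hom.germ_stalkMap_apply, Scheme.Hom.app_eq_appLE, hr]
  exact TopCat.Presheaf.germ_res_apply ..

end ClosedImmersion

end AlgebraicGeometry

/-- Pushouts of rows of subtraction sequences form a subtraction sequence.  Consider a 3×3
diagram of schemes with rows `X' ← W' → Y'`, `X ← W → Y`, `X'' ← W'' → Y''`, in which all six
horizontal maps out of the middle column are closed immersions, the vertical maps from the
top row (`X' → X`, `W' → W`, `Y' → Y`) are closed immersions, the vertical maps from the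
bottom row (`X'' → X`, `W'' → W`, `Y'' → Y`) are open immersions, each column is a
subtraction sequence, all six small squares commute, and the two top squares are pullback
squares.  Then the induced morphisms on the row-wise pushouts form a subtraction sequence
`X' ⊔_{W'} Y' → X ⊔_W Y ← X'' ⊔_{W''} Y''`. -/
theorem pushout_of_subtraction_sequences {W' X' Y' W X Y W'' X'' Y'' : Scheme.{u}}
    -- rows
    (a' : W' ⟶ X') (b' : W' ⟶ Y') (a : W ⟶ X) (b : W ⟶ Y) (a'' : W'' ⟶ X'') (b'' : W'' ⟶ Y'')
    [IsClosedImmersion a'] [IsClosedImmersion b'] [IsClosedImmersion a]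
    [IsClosedImmersion b] [IsClosedImmersion a''] [IsClosedImmersion b'']
    -- vertical closed immersions from the top row
    (x' : X' ⟶ X) (w' : W' ⟶ W) (y' : Y' ⟶ Y)
    [IsClosedImmersion x'] [IsClosedImmersion w'] [IsClosedImmersion y']
    -- vertical open immersions from the bottom row
    (x'' : X'' ⟶ X) (w'' : W'' ⟶ W) (y'' : Y'' ⟶ Y)
    [IsOpenImmersion x''] [IsOpenImmersion w''] [IsOpenImmersion y'']
    -- the columns are subtraction sequences
    (hX : Set.range x''.base = (Set.range x'.base)ᶜ)
    (hW : Set.range w''.base = (Set.range w'.base)ᶜ)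
    (hY : Set.range y''.base = (Set.range y'.base)ᶜ)
    -- all six small squares commute
    (e₁ : a' ≫ x' = w' ≫ a) (e₂ : b' ≫ y' = w' ≫ b)
    (e₃ : a'' ≫ x'' = w'' ≫ a) (e₄ : b'' ≫ y'' = w'' ≫ b)
    -- the two top squares are cartesian
    (hpb₁ : IsPullback a' w' x' a) (hpb₂ : IsPullback b' w' y' b)
    -- the row-wise pushouts exist
    [HasPushout a' b'] [HasPushout a b] [HasPushout a'' b''] :
    IsClosedImmersion (pushout.map a' b' a b x' y' w' e₁ e₂) ∧
    IsOpenImmersion (pushout.map a'' b'' a b x'' y'' w'' e₃ e₄) ∧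
    Set.range (pushout.map a'' b'' a b x'' y'' w'' e₃ e₄).base =
      (Set.range (pushout.map a' b' a b x' y' w' e₁ e₂).base)ᶜ := by
  have hP := isGluing_pushout a b
  have hP' := isGluing_pushout a' b'
  have hP'' := isGluing_pushout a'' b''
  have ei' : pushout.inl a' b' ≫ pushout.map a' b' a b x' y' w' e₁ e₂ = x' ≫ pushout.inl a b :=
    pushout.inl_desc _ _ _
  have ej' : pushout.inr a' b' ≫ pushout.map a' b' a b x' y' w' e₁ e₂ = y' ≫ pushout.inr a b :=
    pushout.inr_desc _ _ _
  have ei'' : pushout.inl a'' b'' ≫ pushout.map a'' b'' a b x'' y'' w'' e₃ e₄ =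
      x'' ≫ pushout.inl a b := pushout.inl_desc _ _ _
  have ej'' : pushout.inr a'' b'' ≫ pushout.map a'' b'' a b x'' y'' w'' e₃ e₄ =
      y'' ≫ pushout.inr a b := pushout.inr_desc _ _ _
  have ha : ∀ w, a.base w ∈ Set.range x''.base → w ∈ Set.range w''.base := by
    rw [hX, hW]
    rintro _ hw ⟨v, rfl⟩
    exact hw ⟨a'.base v, congr($(e₁).base v)⟩
  have hb : ∀ w, b.base w ∈ Set.range y''.base → w ∈ Set.range w''.base := by
    rw [hY, hW]
    rintro _ hw ⟨v, rfl⟩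
    exact hw ⟨b'.base v, congr($(e₂).base v)⟩
  have hi := hP.preimage_image_eq hP'' y''.isOpenEmbedding.injective
    congr($(e₃).toLRSHom.toShHom.hom) congr($(e₄).toLRSHom.toShHom.hom)
    congr($(ei'').toLRSHom.toShHom.hom) congr($(ej'').toLRSHom.toShHom.hom) hb Set.univ
  have hj := hP.flip.preimage_image_eq hP''.flip x''.isOpenEmbedding.injective
    congr($(e₄).toLRSHom.toShHom.hom) congr($(e₃).toLRSHom.toShHom.hom)
    congr($(ej'').toLRSHom.toShHom.hom) congr($(ei'').toLRSHom.toShHom.hom) ha Set.univ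
  have ha' : ∀ w, a.base w ∈ Set.range x'.base → w ∈ Set.range w'.base := by
    rintro w ⟨x, hx⟩
    obtain ⟨v, -, hv⟩ := Scheme.exists_preimage_of_isPullback hpb₁ x w hx
    exact ⟨v, hv⟩
  have hb' : ∀ w, b.base w ∈ Set.range y'.base → w ∈ Set.range w'.base := by
    rintro w ⟨y, hy⟩
    obtain ⟨v, -, hv⟩ := Scheme.exists_preimage_of_isPullback hpb₂ y w hy
    exact ⟨v, hv⟩
  have hi' := hP.preimage_image_eq hP' y'.isClosedEmbedding.injective
    congr($(e₁).toLRSHom.toShHom.hom) congr($(e₂).toLRSHom.toShHom.hom)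
    congr($(ei').toLRSHom.toShHom.hom) congr($(ej').toLRSHom.toShHom.hom) hb' Set.univ
  have hj' := hP.flip.preimage_image_eq hP'.flip x'.isClosedEmbedding.injective
    congr($(e₂).toLRSHom.toShHom.hom) congr($(e₁).toLRSHom.toShHom.hom)
    congr($(ej').toLRSHom.toShHom.hom) congr($(ei').toLRSHom.toShHom.hom) ha' Set.univ
  simp only [Set.preimage_univ, Set.image_univ] at hi hj hi' hj'
  refine ⟨isClosedImmersion_of_isGluing hP hP' hpb₁ e₂ ei' ej', ?_, ?_⟩
  · exact hP.isOpenImmersion hP'' (f := x''.toLRSHom.toShHom.hom) (g := w''.toLRSHom.toShHom.hom)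
      (k := y''.toLRSHom.toShHom.hom) congr($(e₃).toLRSHom.toShHom.hom)
      congr($(e₄).toLRSHom.toShHom.hom) congr($(ei'').toLRSHom.toShHom.hom)
      congr($(ej'').toLRSHom.toShHom.hom) ha hb
  · ext p
    obtain ⟨x, rfl⟩ | ⟨y, rfl⟩ := hP.surj p
    · exact Set.ext_iff.mp (hi.trans (hX.trans congr($(hi')ᶜ).symm)) x
    · exact Set.ext_iff.mp (hj.trans (hY.trans congr($(hj')ᶜ).symm)) y
end

section
/- Let k be a finite field and let X be a scheme equipped with a morphism to Spec k that is of finite type (quasi-compact and locally of finite type). Then the set X(k) of k-points of X, i.e., the set of morphisms Spec k → X over Spec k, is finite. -/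
open AlgebraicGeometry CategoryTheory CategoryTheory.Limits

universe u

/-- A finite type homomorphism out of a finite ring has finitely many left inverses. -/
theorem finite_leftInverses_of_finiteType {k R : Type*} [CommRing k] [Finite k] [CommRing R]
    {φ : k →+* R} (hφ : φ.FiniteType) :
    Finite {ψ : R →+* k // ψ.comp φ = RingHom.id k} := by
  algebraize [φ]
  obtain ⟨s, hs⟩ := Algebra.FiniteType.out (R := k) (A := R)
  refine Finite.of_injective (fun ψ (x : s) ↦ ψ.1 x) fun ψ₁ ψ₂ h ↦ Subtype.ext ?_
  let toAlgHom (ψ : {ψ : R →+* k // ψ.comp φ = RingHom.id k}) : R →ₐ[k] k :=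
    { ψ.1 with commutes' := fun a ↦ RingHom.congr_fun ψ.2 a }
  have key : toAlgHom ψ₁ = toAlgHom ψ₂ :=
    AlgHom.ext_of_adjoin_eq_top hs fun x hx ↦ congr_fun h ⟨x, hx⟩
  exact RingHom.ext fun x ↦ DFunLike.congr_fun key x

/-- A finite type affine scheme over a finite ring has finitely many sections. -/
theorem AlgebraicGeometry.finite_sections_of_Spec {k R : CommRingCat.{u}} [Finite k]
    (f : Spec R ⟶ Spec k) [LocallyOfFiniteType f] :
    Finite {g : Spec k ⟶ Spec R // g ≫ f = 𝟙 (Spec k)} := by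
  obtain ⟨φ, rfl⟩ := Spec.map_surjective f
  have hφ : φ.hom.FiniteType :=
    (HasRingHomProperty.Spec_iff (P := @LocallyOfFiniteType)).mp inferInstance
  have := finite_leftInverses_of_finiteType hφ
  refine Finite.of_surjective (α := {ψ : R →+* k // ψ.comp φ.hom = RingHom.id k})
    (fun ψ ↦ ⟨Spec.map (CommRingCat.ofHom ψ.1), ?_⟩) ?_
  · rw [← Spec.map_comp, ← Spec.map_id]
    exact congr_arg _ (CommRingCat.hom_ext ψ.2)
  · rintro ⟨g, hg⟩
    obtain ⟨ψ, rfl⟩ := Spec.map_surjective g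
    rw [← Spec.map_comp, ← Spec.map_id] at hg
    exact ⟨⟨ψ.hom, congr_arg CommRingCat.Hom.hom (Spec.map_injective hg)⟩, rfl⟩

/-- Let `k` be a finite field and let `X` be a scheme with a morphism to `Spec k` that is of
finite type (quasi-compact and locally of finite type).  Then the set `X(k)` of `k`-points of
`X`, i.e. sections `Spec k → X` of the structure morphism, is finite. -/
theorem finite_kPoints_of_finiteType (k : Type u) [Field k] [Finite k]
    (X : Scheme.{u}) (f : X ⟶ Spec (CommRingCat.of k))
    [QuasiCompact f] [LocallyOfFiniteType f] :
    Finite {g : Spec (CommRingCat.of k) ⟶ X // g ≫ f = 𝟙 (Spec (CommRingCat.of k))} := by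
  have : CompactSpace X := QuasiCompact.compactSpace_of_compactSpace f
  have : Finite (CommRingCat.of k) := ‹Finite k›
  let 𝒰 := X.affineCover.finiteSubcover
  have : ∀ i : 𝒰.I₀, Finite {g : Spec (CommRingCat.of k) ⟶ 𝒰.X i //
      g ≫ 𝒰.f i ≫ f = 𝟙 (Spec (CommRingCat.of k))} :=
    fun i ↦ by
      have : LocallyOfFiniteType (𝒰.f i ≫ f) := inferInstance
      exact @finite_sections_of_Spec _ _ _ (𝒰.f i ≫ f) this
  refine Finite.of_surjective (α := Σ i : 𝒰.I₀, {g : Spec (CommRingCat.of k) ⟶ 𝒰.X i //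
      g ≫ 𝒰.f i ≫ f = 𝟙 (Spec (CommRingCat.of k))})
    (fun g ↦ ⟨g.2.1 ≫ 𝒰.f g.1, by rw [Category.assoc, g.2.2]⟩) ?_
  rintro ⟨g, hg⟩
  obtain ⟨i, y, hy⟩ := 𝒰.exists_eq (g (IsLocalRing.closedPoint k))
  have : Subsingleton (Spec (CommRingCat.of k)) :=
    inferInstanceAs (Subsingleton (PrimeSpectrum k))
  have hr : Set.range g ⊆ Set.range (𝒰.f i) := by
    rintro _ ⟨x, rfl⟩
    exact ⟨y, hy.trans (congr_arg g (Subsingleton.elim _ _))⟩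
  have hl := IsOpenImmersion.lift_fac (𝒰.f i) g hr
  exact ⟨⟨i, IsOpenImmersion.lift (𝒰.f i) g hr, by rw [← Category.assoc, hl, hg]⟩,
    Subtype.ext hl⟩
end
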